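/- (Stanley, Hillman–Grassl) For every partition λ, the identity Σ_{n≥0} r_λ(n)·qⁿ = ∏_{□∈λ} (1 − q^{h(□)})^{−1} holds in the ring of formal power series ℤ[[q]], where r_λ(n) denotes the number of reversed plane partitions of shape λ and size n. -/

import Mathlib

/-- The number of reversed plane partitions of shape `μ` and size `n`: functions
`f : ℕ × ℕ → ℕ` supported on the cells of `μ`, nondecreasing along rows and columns,
with total sum `n`. -/
noncomputable def rppCount (μ : YoungDiagram) (n : ℕ) : ℕ :=
  Nat.card {f : ℕ × ℕ → ℕ //
    (∀ c, c ∉ μ → f c = 0) ∧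
    (∀ c c', c ∈ μ → c' ∈ μ → c.1 ≤ c'.1 → c.2 ≤ c'.2 → f c ≤ f c') ∧
    (∑ c ∈ μ.cells, f c) = n}

namespace HillmanGrassl

/-- The functions on `ℕ × ℕ` that vanish outside `μ`. -/
def supportedOn (μ : YoungDiagram) : Set (ℕ × ℕ → ℕ) := {f | ∀ x, x ∉ μ → f x = 0}

/-- `f` is nondecreasing along each pair of adjacent cells of `μ`. -/
def StepMono (μ : YoungDiagram) (f : ℕ × ℕ → ℕ) : Prop :=
  (∀ i j, (i + 1, j) ∈ μ → f (i, j) ≤ f (i + 1, j)) ∧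
    ∀ i j, (i, j + 1) ∈ μ → f (i, j) ≤ f (i, j + 1)

/-- The reversed plane partitions of shape `μ`, extended by zero. -/
def rpp (μ : YoungDiagram) : Set (ℕ × ℕ → ℕ) := {f | f ∈ supportedOn μ ∧ StepMono μ f}

theorem stepMono_iff {μ : YoungDiagram} {f : ℕ × ℕ → ℕ} :
    StepMono μ f ↔
      ∀ c c', c ∈ μ → c' ∈ μ → c.1 ≤ c'.1 → c.2 ≤ c'.2 → f c ≤ f c' := by
  constructor
  · rintro ⟨hcol, hrow⟩ ⟨i, j⟩ ⟨i', j'⟩ - hc' hi hj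
    obtain ⟨k, rfl⟩ := Nat.exists_eq_add_of_le hi
    obtain ⟨l, rfl⟩ := Nat.exists_eq_add_of_le hj
    have column : ∀ k, (i + k, j) ∈ μ → f (i, j) ≤ f (i + k, j) := by
      intro k
      induction k with
      | zero => simp
      | succ k ih =>
        intro h
        exact (ih (μ.up_left_mem (by omega) le_rfl h)).trans (hcol _ _ h)
    have row : ∀ l, (i + k, j + l) ∈ μ → f (i + k, j) ≤ f (i + k, j + l) := by
      intro l
      induction l with
      | zero => simp
      | succ l ih =>
        intro h
        exact (ih (μ.up_left_mem le_rfl (by omega) h)).trans (hrow _ _ h)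
    exact (column k (μ.up_left_mem le_rfl (by omega) hc')).trans (row l hc')
  · intro h
    exact ⟨fun i j hx => h _ _ (μ.up_left_mem (by omega) le_rfl hx) hx (by simp) (by simp),
      fun i j hx => h _ _ (μ.up_left_mem le_rfl (by omega) hx) hx (by simp) (by simp)⟩

/-- The value of `f` at the upper neighbour, or `0` in the top row. -/
def up (f : ℕ × ℕ → ℕ) : ℕ × ℕ → ℕ
  | (0, _) => 0
  | (i + 1, j) => f (i, j)

/-- The value of `f` at the left neighbour, or `0` in the first column. -/
def left (f : ℕ × ℕ → ℕ) : ℕ × ℕ → ℕ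
  | (_, 0) => 0
  | (i, j + 1) => f (i, j)

/-- Replace the value of `f` at `c` by `v` and reflect each value strictly before `c` on its
diagonal in the interval of values allowed by the four neighbours. -/
def toggle (c : ℕ × ℕ) (v : ℕ) (f : ℕ × ℕ → ℕ) (x : ℕ × ℕ) : ℕ :=
  if x = c then v
  else if x.1 < c.1 ∧ x.1 + c.2 = x.2 + c.1 then
    max (up f x) (left f x) + min (f (x.1 + 1, x.2)) (f (x.1, x.2 + 1)) - f x
  else f x

theorem toggle_self (c : ℕ × ℕ) (v : ℕ) (f : ℕ × ℕ → ℕ) : toggle c v f c = v := by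
  simp [toggle]

theorem toggle_of_ne_diagonal {c x : ℕ × ℕ} (v : ℕ) (f : ℕ × ℕ → ℕ)
    (h : x.1 + c.2 ≠ x.2 + c.1) : toggle c v f x = f x := by
  have hne : x ≠ c := by rintro rfl; omega
  simp [toggle, h, hne]

theorem toggle_of_diagonal {c x : ℕ × ℕ} (v : ℕ) (f : ℕ × ℕ → ℕ) (hlt : x.1 < c.1)
    (h : x.1 + c.2 = x.2 + c.1) : toggle c v f x =
      max (up f x) (left f x) + min (f (x.1 + 1, x.2)) (f (x.1, x.2 + 1)) - f x := by
  have hne : x ≠ c := by rintro rfl; omega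
  simp [toggle, h, hne, hlt]

theorem up_toggle {c x : ℕ × ℕ} (v : ℕ) (f : ℕ × ℕ → ℕ) (h : x.1 + c.2 = x.2 + c.1) :
    up (toggle c v f) x = up f x := by
  obtain ⟨_ | i, j⟩ := x
  · rfl
  · exact toggle_of_ne_diagonal v f (by simp at h ⊢; omega)

theorem left_toggle {c x : ℕ × ℕ} (v : ℕ) (f : ℕ × ℕ → ℕ) (h : x.1 + c.2 = x.2 + c.1) :
    left (toggle c v f) x = left f x := by
  obtain ⟨i, _ | j⟩ := x
  · rfl
  · exact toggle_of_ne_diagonal v f (by simp at h ⊢; omega)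

theorem StepMono.up_le {μ : YoungDiagram} {f : ℕ × ℕ → ℕ} (hf : StepMono μ f) {x : ℕ × ℕ}
    (hx : x ∈ μ) : up f x ≤ f x := by
  obtain ⟨_ | i, j⟩ := x
  · exact Nat.zero_le _
  · exact hf.1 i j hx

theorem StepMono.left_le {μ : YoungDiagram} {f : ℕ × ℕ → ℕ} (hf : StepMono μ f) {x : ℕ × ℕ}
    (hx : x ∈ μ) : left f x ≤ f x := by
  obtain ⟨i, _ | j⟩ := x
  · exact Nat.zero_le _
  · exact hf.2 i j hx

theorem mem_iff_of_erase {μ ν : YoungDiagram} {c : ℕ × ℕ} (hν : ν.cells = μ.cells.erase c)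
    (x : ℕ × ℕ) : x ∈ ν ↔ x ≠ c ∧ x ∈ μ := by
  rw [← YoungDiagram.mem_cells, hν, Finset.mem_erase, YoungDiagram.mem_cells]

section Corner

variable {μ ν : YoungDiagram} {c : ℕ × ℕ}

theorem eq_of_le_of_mem {x : ℕ × ℕ} (hν : ν.cells = μ.cells.erase c) (hx : x ∈ μ)
    (h₁ : c.1 ≤ x.1) (h₂ : c.2 ≤ x.2) : x = c := by
  by_contra hne
  have := ν.up_left_mem h₁ h₂ ((mem_iff_of_erase hν x).2 ⟨hne, hx⟩)
  exact ((mem_iff_of_erase hν c).1 this).1 rfl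

theorem mem_of_le_of_ne {x : ℕ × ℕ} (hc : c ∈ μ) (hν : ν.cells = μ.cells.erase c)
    (h₁ : x.1 ≤ c.1) (h₂ : x.2 ≤ c.2) (hne : x ≠ c) : x ∈ ν :=
  (mem_iff_of_erase hν x).2 ⟨hne, μ.up_left_mem h₁ h₂ hc⟩

theorem StepMono.toggle {f : ℕ × ℕ → ℕ} (hc : c ∈ μ) (hν : ν.cells = μ.cells.erase c)
    (hf : StepMono ν f) (v : ℕ) : StepMono ν (toggle c v f) := by
  obtain ⟨p, q⟩ := c
  have bounds : ∀ i j, i < p → i + q = j + p →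
      up f (i, j) ≤ f (i, j) ∧ left f (i, j) ≤ f (i, j) ∧
      f (i, j) ≤ f (i + 1, j) ∧ f (i, j) ≤ f (i, j + 1) := by
    intro i j hi hj
    have mem : ∀ i' j', i' ≤ p → j' ≤ q → i' + q ≠ j' + p ∨ i' < p → (i', j') ∈ ν := by
      intro i' j' h₁ h₂ h₃
      refine mem_of_le_of_ne hc hν h₁ h₂ ?_
      rintro h
      simp at h
      omega
    exact ⟨hf.up_le (mem _ _ (by omega) (by omega) (by omega)),
      hf.left_le (mem _ _ (by omega) (by omega) (by omega)),
      hf.1 _ _ (mem _ _ (by omega) (by omega) (by omega)),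
      hf.2 _ _ (mem _ _ (by omega) (by omega) (by omega))⟩
  have diagonal : ∀ i j, (i, j) ∈ ν → i + q = j + p → i < p := by
    intro i j hx hij
    obtain ⟨hne, hx⟩ := (mem_iff_of_erase hν _).1 hx
    by_contra hlt
    exact hne (eq_of_le_of_mem hν hx (by simp; omega) (by simp; omega))
  constructor
  · intro i j hx
    by_cases hz : i + 1 + q = j + p
    · have hlt := diagonal _ _ hx hz
      have hb := bounds _ _ hlt hz
      rw [toggle_of_diagonal v f (x := (i + 1, j)) hlt hz,
        toggle_of_ne_diagonal v f (x := (i, j)) (by simp; omega)]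
      simp only [up] at hb ⊢
      omega
    · rw [toggle_of_ne_diagonal v f (x := (i + 1, j)) hz]
      by_cases hy : i + q = j + p
      · have hlt := diagonal _ _ (ν.up_left_mem (by omega) le_rfl hx) hy
        have hb := bounds _ _ hlt hy
        rw [toggle_of_diagonal v f (x := (i, j)) hlt hy]
        simp only
        omega
      · rw [toggle_of_ne_diagonal v f (x := (i, j)) hy]
        exact hf.1 _ _ hx
  · intro i j hx
    by_cases hz : i + q = j + 1 + p
    · have hlt := diagonal _ _ hx hz
      have hb := bounds _ _ hlt hz
      rw [toggle_of_diagonal v f (x := (i, j + 1)) hlt hz,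
        toggle_of_ne_diagonal v f (x := (i, j)) (by simp; omega)]
      simp only [left] at hb ⊢
      omega
    · rw [toggle_of_ne_diagonal v f (x := (i, j + 1)) hz]
      by_cases hy : i + q = j + p
      · have hlt := diagonal _ _ (ν.up_left_mem le_rfl (by omega) hx) hy
        have hb := bounds _ _ hlt hy
        rw [toggle_of_diagonal v f (x := (i, j)) hlt hy]
        simp only
        omega
      · rw [toggle_of_ne_diagonal v f (x := (i, j)) hy]
        exact hf.2 _ _ hx

theorem toggle_toggle {f : ℕ × ℕ → ℕ} (hc : c ∈ μ) (hν : ν.cells = μ.cells.erase c)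
    (hf : StepMono ν f) (v w : ℕ) : toggle c v (toggle c w f) = Function.update f c v := by
  funext x
  by_cases hxc : x = c
  · subst hxc
    simp [toggle_self]
  rw [Function.update_of_ne hxc]
  by_cases hd : x.1 + c.2 = x.2 + c.1
  · by_cases hlt : x.1 < c.1
    · have hdown : (x.1 + 1, x.2) ∈ ν := mem_of_le_of_ne hc hν (by simp; omega) (by simp; omega)
        (by rintro rfl; simp at hd; omega)
      have hright : (x.1, x.2 + 1) ∈ ν := mem_of_le_of_ne hc hν (by simp; omega) (by simp; omega)
        (by rintro rfl; simp at hd; omega)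
      have h₁ := hf.1 _ _ hdown
      have h₂ := hf.2 _ _ hright
      rw [toggle_of_diagonal _ _ hlt hd, toggle_of_diagonal _ _ hlt hd, up_toggle _ _ hd,
        left_toggle _ _ hd, toggle_of_ne_diagonal _ _ (by simp; omega),
        toggle_of_ne_diagonal _ _ (by simp; omega)]
      simp only [Prod.mk.eta] at h₁ h₂
      omega
    · simp [toggle, hxc, hlt]
  · rw [toggle_of_ne_diagonal _ _ hd, toggle_of_ne_diagonal _ _ hd]

theorem StepMono.of_erase {f : ℕ × ℕ → ℕ} (hν : ν.cells = μ.cells.erase c)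
    (hf : StepMono μ f) : StepMono ν f :=
  ⟨fun i j hx => hf.1 i j ((mem_iff_of_erase hν _).1 hx).2,
    fun i j hx => hf.2 i j ((mem_iff_of_erase hν _).1 hx).2⟩

theorem toggle_mem_supportedOn {f : ℕ × ℕ → ℕ} (hc : c ∈ μ) (hf : f ∈ supportedOn μ) (v : ℕ) :
    toggle c v f ∈ supportedOn μ := by
  intro x hx
  have hxc : x ≠ c := by rintro rfl; exact hx hc
  have hd : ¬(x.1 < c.1 ∧ x.1 + c.2 = x.2 + c.1) := fun h =>
    hx (μ.up_left_mem h.1.le (by omega) hc)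
  rw [toggle, if_neg hxc, if_neg hd, hf x hx]

theorem toggle_zero_mem_rpp {f : ℕ × ℕ → ℕ} (hc : c ∈ μ) (hν : ν.cells = μ.cells.erase c)
    (hf : f ∈ rpp μ) : toggle c 0 f ∈ rpp ν := by
  refine ⟨fun x hx => ?_, (hf.2.of_erase hν).toggle hc hν 0⟩
  by_cases hxc : x = c
  · rw [hxc, toggle_self]
  · exact toggle_mem_supportedOn hc hf.1 0 x fun h => hx ((mem_iff_of_erase hν x).2 ⟨hxc, h⟩)

theorem toggle_mem_rpp {g : ℕ × ℕ → ℕ} (hc : c ∈ μ) (hν : ν.cells = μ.cells.erase c)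
    (hg : g ∈ rpp ν) {v : ℕ} (hv : max (up g c) (left g c) ≤ v) : toggle c v g ∈ rpp μ := by
  have hsupp : g ∈ supportedOn μ := fun x hx =>
    hg.1 x fun h => hx ((mem_iff_of_erase hν x).1 h).2
  refine ⟨toggle_mem_supportedOn hc hsupp v, fun i j hx => ?_, fun i j hx => ?_⟩
  · by_cases hxc : (i + 1, j) = c
    · subst hxc
      rw [toggle_self, toggle_of_ne_diagonal _ _ (by simp; omega)]
      exact (le_max_left _ _).trans hv
    · exact (hg.2.toggle hc hν v).1 i j ((mem_iff_of_erase hν _).2 ⟨hxc, hx⟩)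
  · by_cases hxc : (i, j + 1) = c
    · subst hxc
      rw [toggle_self, toggle_of_ne_diagonal _ _ (by simp; omega)]
      exact (le_max_right _ _).trans hv
    · exact (hg.2.toggle hc hν v).2 i j ((mem_iff_of_erase hν _).2 ⟨hxc, hx⟩)

/-- The sum of the values of `f` on the cells of `μ` of content `d`. -/
def diagSum (μ : YoungDiagram) (f : ℕ × ℕ → ℕ) (d : ℤ) : ℕ :=
  ∑ x ∈ μ.cells with (x.2 : ℤ) - x.1 = d, f x

/-- The sum of the values of `a` on the cells of `μ` whose hook has a cell of content `d`. -/
def hookSum (μ : YoungDiagram) (a : ℕ × ℕ → ℕ) (d : ℤ) : ℕ :=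
  ∑ x ∈ μ.cells,
    if (x.2 : ℤ) + 1 - μ.colLen x.2 ≤ d ∧ d ≤ (μ.rowLen x.1 : ℤ) - 1 - x.1 then a x else 0

theorem diagSum_succ_eq_sum_up (hc : c ∈ μ) (hν : ν.cells = μ.cells.erase c) (f : ℕ × ℕ → ℕ) :
    diagSum μ f ((c.2 : ℤ) - c.1 + 1) =
      ∑ x ∈ μ.cells with (x.2 : ℤ) - x.1 = (c.2 : ℤ) - c.1, up f x := by
  refine Finset.sum_of_injOn (fun x => (x.1 + 1, x.2)) ?_ ?_ ?_ ?_
  · rintro ⟨i, j⟩ - ⟨i', j'⟩ - h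
    simpa using h
  · rintro ⟨i, j⟩ hx
    simp only [Finset.coe_filter, YoungDiagram.mem_cells, Set.mem_ofPred_eq] at hx ⊢
    refine ⟨?_, by push_cast; omega⟩
    have hlt : i < c.1 := by
      by_contra hlt
      have := eq_of_le_of_mem hν hx.1 (by simp; omega) (by simp; omega)
      subst this
      dsimp only at hx
      omega
    exact μ.up_left_mem (by omega) (by omega) hc
  · rintro ⟨_ | i, j⟩ hx hne
    · rfl
    · refine absurd ⟨(i, j), ?_, rfl⟩ hne
      simp only [Finset.coe_filter, Finset.mem_filter, YoungDiagram.mem_cells,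
        Set.mem_ofPred_eq] at hx ⊢
      exact ⟨μ.up_left_mem (by omega) le_rfl hx.1, by push_cast at hx; omega⟩
  · intro x _
    rfl

theorem diagSum_pred_eq_sum_left (hc : c ∈ μ) (hν : ν.cells = μ.cells.erase c)
    (f : ℕ × ℕ → ℕ) :
    diagSum μ f ((c.2 : ℤ) - c.1 - 1) =
      ∑ x ∈ μ.cells with (x.2 : ℤ) - x.1 = (c.2 : ℤ) - c.1, left f x := by
  refine Finset.sum_of_injOn (fun x => (x.1, x.2 + 1)) ?_ ?_ ?_ ?_
  · rintro ⟨i, j⟩ - ⟨i', j'⟩ - h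
    simpa using h
  · rintro ⟨i, j⟩ hx
    simp only [Finset.coe_filter, YoungDiagram.mem_cells, Set.mem_ofPred_eq] at hx ⊢
    refine ⟨?_, by push_cast; omega⟩
    have hlt : j < c.2 := by
      by_contra hlt
      have := eq_of_le_of_mem hν hx.1 (by simp; omega) (by simp; omega)
      subst this
      dsimp only at hx
      omega
    exact μ.up_left_mem (by omega) (by omega) hc
  · rintro ⟨i, _ | j⟩ hx hne
    · rfl
    · refine absurd ⟨(i, j), ?_, rfl⟩ hne
      simp only [Finset.coe_filter, Finset.mem_filter, YoungDiagram.mem_cells,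
        Set.mem_ofPred_eq] at hx ⊢
      exact ⟨μ.up_left_mem le_rfl (by omega) hx.1, by push_cast at hx; omega⟩
  · intro x _
    rfl

theorem lt_of_mem_erase_of_diagonal {x : ℕ × ℕ} (hν : ν.cells = μ.cells.erase c) (hx : x ∈ ν)
    (hd : (x.2 : ℤ) - x.1 = (c.2 : ℤ) - c.1) : x.1 < c.1 := by
  obtain ⟨hne, hx⟩ := (mem_iff_of_erase hν x).1 hx
  by_contra hlt
  exact hne (eq_of_le_of_mem hν hx (by omega) (by omega))

theorem sum_min_next_eq_sum_min_prev (hc : c ∈ μ) (hν : ν.cells = μ.cells.erase c)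
    (f : ℕ × ℕ → ℕ) :
    ∑ x ∈ ν.cells with (x.2 : ℤ) - x.1 = (c.2 : ℤ) - c.1,
        min (f (x.1 + 1, x.2)) (f (x.1, x.2 + 1)) =
      ∑ x ∈ μ.cells with (x.2 : ℤ) - x.1 = (c.2 : ℤ) - c.1, min (up f x) (left f x) := by
  refine Finset.sum_of_injOn (fun x => (x.1 + 1, x.2 + 1)) ?_ ?_ ?_ ?_
  · rintro ⟨i, j⟩ - ⟨i', j'⟩ - h
    simpa using h
  · rintro ⟨i, j⟩ hx
    simp only [Finset.coe_filter, YoungDiagram.mem_cells, Set.mem_ofPred_eq] at hx ⊢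
    have hlt := lt_of_mem_erase_of_diagonal hν hx.1 hx.2
    exact ⟨μ.up_left_mem (by simp at hlt; omega) (by simp at hlt; omega) hc, by push_cast; omega⟩
  · rintro ⟨_ | i, _ | j⟩ hx hne
    · rfl
    · exact Nat.zero_min _
    · exact Nat.min_zero _
    · refine absurd ⟨(i, j), ?_, rfl⟩ hne
      simp only [Finset.coe_filter, Finset.mem_filter, YoungDiagram.mem_cells,
        Set.mem_ofPred_eq] at hx ⊢
      refine ⟨(mem_iff_of_erase hν _).2 ⟨?_, μ.up_left_mem (by omega) (by omega) hx.1⟩,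
        by push_cast at hx; omega⟩
      rintro rfl
      simpa using eq_of_le_of_mem hν hx.1 (by simp) (by simp)
  · intro x _
    exact min_comm _ _

theorem filter_diagonal_erase (hc : c ∈ μ) (hν : ν.cells = μ.cells.erase c) :
    {x ∈ μ.cells | (x.2 : ℤ) - x.1 = (c.2 : ℤ) - c.1} =
      insert c {x ∈ ν.cells | (x.2 : ℤ) - x.1 = (c.2 : ℤ) - c.1} := by
  ext x
  by_cases hx : x = c
  · subst hx; simp [hc]
  · simp [hν, hx]

theorem diagSum_toggle_zero (hc : c ∈ μ) (hν : ν.cells = μ.cells.erase c) {f : ℕ × ℕ → ℕ}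
    (hf : f ∈ rpp μ) :
    diagSum μ f ((c.2 : ℤ) - c.1) + diagSum ν (toggle c 0 f) ((c.2 : ℤ) - c.1) =
      diagSum μ f ((c.2 : ℤ) - c.1 - 1) + diagSum μ f ((c.2 : ℤ) - c.1 + 1) +
        (f c - max (up f c) (left f c)) := by
  have hcν : c ∉ ν.cells := by simp [hν]
  have hnot : c ∉ {x ∈ ν.cells | (x.2 : ℤ) - x.1 = (c.2 : ℤ) - c.1} := by simp [hcν]
  have hsplit : ∀ g : ℕ × ℕ → ℕ,
      ∑ x ∈ μ.cells with (x.2 : ℤ) - x.1 = (c.2 : ℤ) - c.1, g x =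
        g c + ∑ x ∈ ν.cells with (x.2 : ℤ) - x.1 = (c.2 : ℤ) - c.1, g x := fun g => by
    rw [filter_diagonal_erase hc hν, Finset.sum_insert hnot]
  have htoggle : diagSum ν (toggle c 0 f) ((c.2 : ℤ) - c.1) +
      ∑ x ∈ ν.cells with (x.2 : ℤ) - x.1 = (c.2 : ℤ) - c.1, f x =
      ∑ x ∈ ν.cells with (x.2 : ℤ) - x.1 = (c.2 : ℤ) - c.1, max (up f x) (left f x) +
      ∑ x ∈ ν.cells with (x.2 : ℤ) - x.1 = (c.2 : ℤ) - c.1,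
        min (f (x.1 + 1, x.2)) (f (x.1, x.2 + 1)) := by
    rw [diagSum, ← Finset.sum_add_distrib, ← Finset.sum_add_distrib]
    refine Finset.sum_congr rfl fun x hx => ?_
    rw [Finset.mem_filter, YoungDiagram.mem_cells] at hx
    have hlt := lt_of_mem_erase_of_diagonal hν hx.1 hx.2
    have h₁ := hf.2.1 x.1 x.2 (μ.up_left_mem (by omega) (by omega) hc)
    have h₂ := hf.2.2 x.1 x.2 (μ.up_left_mem (by omega) (by omega) hc)
    rw [toggle_of_diagonal 0 f hlt (by omega)]
    simp only [Prod.mk.eta] at h₁ h₂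
    omega
  have hmaxmin : ∑ x ∈ μ.cells with (x.2 : ℤ) - x.1 = (c.2 : ℤ) - c.1, max (up f x) (left f x) +
      ∑ x ∈ μ.cells with (x.2 : ℤ) - x.1 = (c.2 : ℤ) - c.1, min (up f x) (left f x) =
      ∑ x ∈ μ.cells with (x.2 : ℤ) - x.1 = (c.2 : ℤ) - c.1, up f x +
      ∑ x ∈ μ.cells with (x.2 : ℤ) - x.1 = (c.2 : ℤ) - c.1, left f x := by
    simp only [← Finset.sum_add_distrib]
    exact Finset.sum_congr rfl fun x _ => by omega
  have hsplit_f := hsplit f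
  have hsplit_max := hsplit fun x => max (up f x) (left f x)
  have hmin := sum_min_next_eq_sum_min_prev hc hν f
  have hup := diagSum_succ_eq_sum_up hc hν f
  have hleft := diagSum_pred_eq_sum_left hc hν f
  have h₁ := hf.2.up_le hc
  have h₂ := hf.2.left_le hc
  have hdef : diagSum μ f ((c.2 : ℤ) - c.1) =
    ∑ x ∈ μ.cells with (x.2 : ℤ) - x.1 = (c.2 : ℤ) - c.1, f x := rfl
  omega

theorem diagSum_toggle_of_ne (hν : ν.cells = μ.cells.erase c) (f : ℕ × ℕ → ℕ) (v : ℕ) {d : ℤ}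
    (hd : d ≠ (c.2 : ℤ) - c.1) : diagSum ν (toggle c v f) d = diagSum μ f d := by
  have hcells : {x ∈ ν.cells | (x.2 : ℤ) - x.1 = d} = {x ∈ μ.cells | (x.2 : ℤ) - x.1 = d} := by
    ext x
    by_cases hx : x = c
    · subst hx; simp [hd.symm]
    · simp [hν, hx]
  rw [diagSum, hcells]
  refine Finset.sum_congr rfl fun x hx => toggle_of_ne_diagonal v f ?_
  rw [Finset.mem_filter] at hx
  omega

theorem rowLen_corner (hc : c ∈ μ) (hν : ν.cells = μ.cells.erase c) :
    μ.rowLen c.1 = c.2 + 1 ∧ ν.rowLen c.1 = c.2 ∧ ∀ i, i ≠ c.1 → ν.rowLen i = μ.rowLen i := by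
  obtain ⟨p, q⟩ := c
  have hμ : ∀ j, (p, j) ∈ μ ↔ j < q + 1 := fun j => by
    refine ⟨fun h => ?_, fun h => μ.up_left_mem le_rfl (by omega) hc⟩
    by_contra hj
    have := eq_of_le_of_mem hν h le_rfl (by simp; omega)
    simp at this
    omega
  have ext_lt : ∀ m n : ℕ, (∀ j, j < m ↔ j < n) → m = n := fun m n h => by
    have := h m
    have := h n
    omega
  refine ⟨ext_lt _ _ fun j => ?_, ext_lt _ _ fun j => ?_, fun i hi => ext_lt _ _ fun j => ?_⟩
  · rw [← YoungDiagram.mem_iff_lt_rowLen, hμ]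
  · rw [← YoungDiagram.mem_iff_lt_rowLen, mem_iff_of_erase hν, hμ]
    simp
    omega
  · rw [← YoungDiagram.mem_iff_lt_rowLen, mem_iff_of_erase hν,
      ← YoungDiagram.mem_iff_lt_rowLen]
    simp at hi
    simp [hi]

theorem colLen_corner (hc : c ∈ μ) (hν : ν.cells = μ.cells.erase c) :
    μ.colLen c.2 = c.1 + 1 ∧ ν.colLen c.2 = c.1 ∧ ∀ j, j ≠ c.2 → ν.colLen j = μ.colLen j := by
  have hν' : ν.transpose.cells = μ.transpose.cells.erase c.swap := by
    ext x
    rw [Finset.mem_erase, YoungDiagram.mem_cells, YoungDiagram.mem_cells,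
      YoungDiagram.mem_transpose, YoungDiagram.mem_transpose, mem_iff_of_erase hν,
      Ne, Ne, Prod.swap_eq_iff_eq_swap]
  simpa using rowLen_corner (μ := μ.transpose) (ν := ν.transpose) (c := c.swap) (by simpa) hν'

/-- The hook of a cell is governed by the interval of its contents; deleting the corner `c`
changes this interval only in the row and the column of `c`. -/
theorem hookSum_erase (hc : c ∈ μ) (hν : ν.cells = μ.cells.erase c) {a b : ℕ × ℕ → ℕ}
    (hab : ∀ x ∈ ν, a x = b x) :
    hookSum μ a ((c.2 : ℤ) - c.1) + hookSum ν b ((c.2 : ℤ) - c.1) =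
        hookSum ν b ((c.2 : ℤ) - c.1 - 1) + hookSum ν b ((c.2 : ℤ) - c.1 + 1) + a c ∧
      ∀ d : ℤ, d ≠ (c.2 : ℤ) - c.1 → hookSum μ a d = hookSum ν b d := by
  obtain ⟨hrow, hrow', hrows⟩ := rowLen_corner hc hν
  obtain ⟨hcol, hcol', hcols⟩ := colLen_corner hc hν
  have hcν : c ∉ ν.cells := by simp [hν]
  have hμ : μ.cells = insert c ν.cells := by
    rw [hν, Finset.insert_erase ((YoungDiagram.mem_cells c).2 hc)]
  have cell : ∀ x ∈ ν.cells, x.2 < ν.rowLen x.1 ∧ x.1 < ν.colLen x.2 ∧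
      (x.1 = c.1 ∧ ν.rowLen x.1 = c.2 ∧ μ.rowLen x.1 = c.2 + 1 ∨
        x.1 < c.1 ∧ c.2 < ν.rowLen x.1 ∧ μ.rowLen x.1 = ν.rowLen x.1 ∨
        c.1 < x.1 ∧ ν.rowLen x.1 ≤ c.2 ∧ μ.rowLen x.1 = ν.rowLen x.1) ∧
      (x.2 = c.2 ∧ ν.colLen x.2 = c.1 ∧ μ.colLen x.2 = c.1 + 1 ∨
        x.2 < c.2 ∧ c.1 < ν.colLen x.2 ∧ μ.colLen x.2 = ν.colLen x.2 ∨
        c.2 < x.2 ∧ ν.colLen x.2 ≤ c.1 ∧ μ.colLen x.2 = ν.colLen x.2) := by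
    intro x hx
    refine ⟨YoungDiagram.mem_iff_lt_rowLen.1 hx, YoungDiagram.mem_iff_lt_colLen.1 hx, ?_, ?_⟩
    · rcases lt_trichotomy x.1 c.1 with h | h | h
      · have := hrows x.1 h.ne
        have := μ.rowLen_anti _ _ h.le
        omega
      · rw [h]; omega
      · have := hrows x.1 h.ne'
        have := ν.rowLen_anti _ _ h.le
        omega
    · rcases lt_trichotomy x.2 c.2 with h | h | h
      · have := hcols x.2 h.ne
        have := μ.colLen_anti _ _ h.le
        omega
      · rw [h]; omega
      · have := hcols x.2 h.ne'
        have := ν.colLen_anti _ _ h.le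
        omega
  constructor
  · simp only [hookSum]
    rw [hμ, Finset.sum_insert hcν, if_pos (by omega), add_assoc, add_comm]
    congr 1
    simp only [← Finset.sum_add_distrib]
    refine Finset.sum_congr rfl fun x hx => ?_
    have := cell x hx
    rw [hab x hx]
    split_ifs <;> omega
  · intro d hd
    simp only [hookSum]
    rw [hμ, Finset.sum_insert hcν, if_neg (by omega), zero_add]
    refine Finset.sum_congr rfl fun x hx => ?_
    have := cell x hx
    rw [hab x hx]
    split_ifs <;> omega

end Corner

theorem exists_erase {μ : YoungDiagram} (hμ : μ.cells.Nonempty) :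
    ∃ c ∈ μ, ∃ ν : YoungDiagram, ν.cells = μ.cells.erase c := by
  obtain ⟨c, hc, hmax⟩ := μ.cells.exists_max_image (fun x => x.1 + x.2) hμ
  refine ⟨c, hc, ⟨μ.cells.erase c, ?_⟩, rfl⟩
  intro x y hyx hx
  simp only [Finset.coe_erase, Set.mem_sdiff, Finset.mem_coe, Set.mem_singleton_iff] at hx ⊢
  refine ⟨μ.isLowerSet hyx hx.1, ?_⟩
  rintro rfl
  have h₁ := hyx.1
  have h₂ := hyx.2
  have h₃ := hmax x hx.1
  exact hx.2 (Prod.ext (by omega) (by omega))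

theorem exists_bijOn_diagSum_eq_hookSum (μ : YoungDiagram) :
    ∃ Φ : (ℕ × ℕ → ℕ) → ℕ × ℕ → ℕ, Set.BijOn Φ (rpp μ) (supportedOn μ) ∧
      ∀ f ∈ rpp μ, ∀ d, diagSum μ f d = hookSum μ (Φ f) d := by
  induction hn : μ.cells.card generalizing μ with
  | zero =>
    rw [Finset.card_eq_zero] at hn
    have hmem : ∀ x, x ∉ μ := fun x hx => by
      rw [← YoungDiagram.mem_cells, hn] at hx
      simp at hx
    have hrpp : rpp μ = supportedOn μ := by
      ext f
      exact ⟨fun h => h.1, fun h => ⟨h, fun i j hx => absurd hx (hmem _),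
        fun i j hx => absurd hx (hmem _)⟩⟩
    refine ⟨id, hrpp ▸ Set.bijOn_id _, fun f _ d => ?_⟩
    simp [diagSum, hookSum, hn]
  | succ n ih =>
    obtain ⟨c, hc, ν, hν⟩ := exists_erase (μ := μ) (Finset.card_pos.1 (by omega))
    obtain ⟨Φ, ⟨hmaps, hinj, hsurj⟩, hsum⟩ := ih ν (by
      rw [hν, Finset.card_erase_of_mem ((YoungDiagram.mem_cells c).2 hc), hn]
      rfl)
    have hcν : c ∉ ν := by simp [mem_iff_of_erase hν]
    refine ⟨fun f => Function.update (Φ (toggle c 0 f)) c (f c - max (up f c) (left f c)),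
      ⟨?_, ?_, ?_⟩, ?_⟩
    · intro f hf x hx
      have hxc : x ≠ c := by rintro rfl; exact hx hc
      simp only [Function.update_of_ne hxc]
      exact hmaps (toggle_zero_mem_rpp hc hν hf) x
        fun h => hx ((mem_iff_of_erase hν x).1 h).2
    · intro f hf g hg h
      have hΦ : Φ (toggle c 0 f) = Φ (toggle c 0 g) := by
        funext x
        by_cases hxc : x = c
        · rw [hxc, hmaps (toggle_zero_mem_rpp hc hν hf) c hcν,
            hmaps (toggle_zero_mem_rpp hc hν hg) c hcν]
        · simpa [hxc] using congrFun h x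
      have htoggle := hinj (toggle_zero_mem_rpp hc hν hf) (toggle_zero_mem_rpp hc hν hg) hΦ
      have hup : up f c = up g c := by
        rw [← up_toggle (c := c) 0 f (Nat.add_comm _ _), htoggle, up_toggle (c := c) 0 g (Nat.add_comm _ _)]
      have hleft : left f c = left g c := by
        rw [← left_toggle (c := c) 0 f (Nat.add_comm _ _), htoggle, left_toggle (c := c) 0 g (Nat.add_comm _ _)]
      have hc_eq : f c = g c := by
        have hval := congrFun h c
        simp only [Function.update_self] at hval
        have h₁ := hf.2.up_le hc
        have h₂ := hf.2.left_le hc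
        have h₃ := hg.2.up_le hc
        have h₄ := hg.2.left_le hc
        omega
      have hupdate := congrArg (toggle c (f c)) htoggle
      rwa [toggle_toggle hc hν (hf.2.of_erase hν), toggle_toggle hc hν (hg.2.of_erase hν),
        Function.update_eq_self, hc_eq, Function.update_eq_self] at hupdate
    · intro a ha
      obtain ⟨g, hg, hga⟩ := hsurj (a := Function.update a c 0) (fun x hx => by
        by_cases hxc : x = c
        · simp [hxc]
        · rw [Function.update_of_ne hxc]
          exact ha x fun h => hx ((mem_iff_of_erase hν x).2 ⟨hxc, h⟩))
      refine ⟨toggle c (max (up g c) (left g c) + a c) g,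
        toggle_mem_rpp hc hν hg (Nat.le_add_right _ _), ?_⟩
      have hgc : Function.update g c 0 = g := by
        rw [← hg.1 c hcν, Function.update_eq_self]
      simp only
      rw [toggle_toggle hc hν hg.2, hgc, hga, toggle_self,
        up_toggle _ _ (Nat.add_comm _ _), left_toggle _ _ (Nat.add_comm _ _), Nat.add_sub_cancel_left, Function.update_idem,
        Function.update_eq_self]
    · intro f hf d
      obtain ⟨heq, hne⟩ := hookSum_erase hc hν
        (a := Function.update (Φ (toggle c 0 f)) c (f c - max (up f c) (left f c)))
        (b := Φ (toggle c 0 f)) (fun x hx => by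
          rw [Function.update_of_ne]
          rintro rfl
          exact hcν hx)
      have hν_sum := hsum _ (toggle_zero_mem_rpp hc hν hf)
      by_cases hd : d = (c.2 : ℤ) - c.1
      · subst hd
        rw [Function.update_self, ← hν_sum, ← hν_sum, ← hν_sum,
          diagSum_toggle_of_ne hν f 0 (sub_one_lt _).ne,
          diagSum_toggle_of_ne hν f 0 (lt_add_one _).ne'] at heq
        have := diagSum_toggle_zero hc hν hf
        dsimp only
        omega
      · rw [hne d hd, ← hν_sum, diagSum_toggle_of_ne hν f 0 hd]

/-- The hook length of the cell `x` of `μ`. -/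
def hookLength (μ : YoungDiagram) (x : ℕ × ℕ) : ℕ :=
  μ.rowLen x.1 + μ.colLen x.2 - x.1 - x.2 - 1

theorem hookLength_pos {μ : YoungDiagram} {x : ℕ × ℕ} (hx : x ∈ μ) : 0 < hookLength μ x := by
  have h₁ := YoungDiagram.mem_iff_lt_rowLen.1 hx
  have h₂ := YoungDiagram.mem_iff_lt_colLen.1 hx
  unfold hookLength
  omega

theorem sum_diagSum (μ : YoungDiagram) (f : ℕ × ℕ → ℕ) {D : Finset ℤ}
    (hD : ∀ x ∈ μ, (x.2 : ℤ) - x.1 ∈ D) : ∑ d ∈ D, diagSum μ f d = ∑ x ∈ μ.cells, f x :=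
  Finset.sum_fiberwise_of_maps_to hD f

theorem sum_hookSum (μ : YoungDiagram) (a : ℕ × ℕ → ℕ) {D : Finset ℤ}
    (hD : ∀ x ∈ μ, Finset.Icc ((x.2 : ℤ) + 1 - μ.colLen x.2) ((μ.rowLen x.1 : ℤ) - 1 - x.1) ⊆ D) :
    ∑ d ∈ D, hookSum μ a d = ∑ x ∈ μ.cells, hookLength μ x * a x := by
  simp only [hookSum]
  rw [Finset.sum_comm]
  refine Finset.sum_congr rfl fun x hx => ?_
  have h₁ := YoungDiagram.mem_iff_lt_rowLen.1 hx
  have h₂ := YoungDiagram.mem_iff_lt_colLen.1 hx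
  simp only [← Finset.mem_Icc]
  rw [Finset.sum_ite_mem, Finset.inter_eq_right.2 (hD x hx), Finset.sum_const, Int.card_Icc,
    smul_eq_mul]
  congr 1
  unfold hookLength
  omega

theorem sum_eq_sum_hookLength {μ : YoungDiagram} {f a : ℕ × ℕ → ℕ}
    (h : ∀ d, diagSum μ f d = hookSum μ a d) :
    ∑ x ∈ μ.cells, f x = ∑ x ∈ μ.cells, hookLength μ x * a x := by
  let D : Finset ℤ := Finset.Icc (-(μ.colLen 0 : ℤ)) (μ.rowLen 0)
  have bound : ∀ x ∈ μ, x.2 < μ.rowLen x.1 ∧ x.1 < μ.colLen x.2 ∧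
      μ.rowLen x.1 ≤ μ.rowLen 0 ∧ μ.colLen x.2 ≤ μ.colLen 0 := fun x hx =>
    ⟨YoungDiagram.mem_iff_lt_rowLen.1 hx, YoungDiagram.mem_iff_lt_colLen.1 hx,
      μ.rowLen_anti _ _ (Nat.zero_le _), μ.colLen_anti _ _ (Nat.zero_le _)⟩
  rw [← sum_diagSum μ f (D := D), ← sum_hookSum μ a (D := D)]
  · exact Finset.sum_congr rfl fun d _ => h d
  · intro x hx
    have := bound x hx
    exact Finset.Icc_subset_Icc (by omega) (by omega)
  · intro x hx
    have := bound x hx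
    exact Finset.mem_Icc.2 ⟨by omega, by omega⟩

theorem rppCount_eq_card (μ : YoungDiagram) (n : ℕ) :
    rppCount μ n = Nat.card {a : ℕ × ℕ → ℕ //
      a ∈ supportedOn μ ∧ ∑ x ∈ μ.cells, hookLength μ x * a x = n} := by
  obtain ⟨Φ, hbij, hsum⟩ := exists_bijOn_diagSum_eq_hookSum μ
  have hweight : ∀ f ∈ rpp μ, ∑ x ∈ μ.cells, f x = ∑ x ∈ μ.cells, hookLength μ x * Φ f x :=
    fun f hf => sum_eq_sum_hookLength (hsum f hf)
  have hrpp : ∀ f : ℕ × ℕ → ℕ, ((∀ c, c ∉ μ → f c = 0) ∧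
      (∀ c c', c ∈ μ → c' ∈ μ → c.1 ≤ c'.1 → c.2 ≤ c'.2 → f c ≤ f c') ∧
      (∑ c ∈ μ.cells, f c) = n) ↔ f ∈ rpp μ ∧ ∑ c ∈ μ.cells, f c = n := fun f => by
    rw [← stepMono_iff, ← and_assoc]
    rfl
  unfold rppCount
  simp only [hrpp]
  refine Nat.card_congr (Set.BijOn.equiv Φ (s := {f | f ∈ rpp μ ∧ ∑ c ∈ μ.cells, f c = n})
    (t := {a | a ∈ supportedOn μ ∧ ∑ x ∈ μ.cells, hookLength μ x * a x = n}) ⟨?_, ?_, ?_⟩)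
  · rintro f ⟨hf, hn⟩
    exact ⟨hbij.mapsTo hf, (hweight f hf).symm.trans hn⟩
  · exact hbij.injOn.mono fun f hf => hf.1
  · rintro a ⟨ha, hn⟩
    obtain ⟨f, hf, rfl⟩ := hbij.surjOn ha
    exact ⟨f, ⟨hf, (hweight f hf).trans hn⟩, rfl⟩

theorem invOfUnit_one_sub_X_pow {h : ℕ} (hh : 0 < h) :
    PowerSeries.invOfUnit (1 - (PowerSeries.X : PowerSeries ℤ) ^ h) 1 =
      PowerSeries.mk fun n => if h ∣ n then 1 else 0 := by
  have hconst : PowerSeries.constantCoeff (1 - (PowerSeries.X : PowerSeries ℤ) ^ h) =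
      ((1 : ℤˣ) : ℤ) := by
    simp [hh.ne']
  have hmul : (1 - (PowerSeries.X : PowerSeries ℤ) ^ h) *
      PowerSeries.mk (fun n => if h ∣ n then (1 : ℤ) else 0) = 1 := by
    ext n
    rw [sub_mul, one_mul, map_sub, PowerSeries.coeff_X_pow_mul', PowerSeries.coeff_mk,
      PowerSeries.coeff_one]
    by_cases hn : h ≤ n
    · rw [if_pos hn, PowerSeries.coeff_mk, if_neg (show n ≠ 0 by omega)]
      simp [Nat.dvd_sub_iff_left hn (dvd_refl h)]
    · rw [if_neg hn, sub_zero]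
      rcases Nat.eq_zero_or_pos n with rfl | hpos
      · simp
      · rw [if_neg fun hdvd => hn (Nat.le_of_dvd hpos hdvd), if_neg hpos.ne']
  calc _ = PowerSeries.invOfUnit (1 - (PowerSeries.X : PowerSeries ℤ) ^ h) 1 *
        ((1 - (PowerSeries.X : PowerSeries ℤ) ^ h) *
          PowerSeries.mk (fun n => if h ∣ n then (1 : ℤ) else 0)) := by rw [hmul, mul_one]
    _ = _ := by
      rw [← mul_assoc, mul_comm (PowerSeries.invOfUnit _ _), PowerSeries.mul_invOfUnit _ _ hconst,
        one_mul]

theorem coeff_prod_invOfUnit {ι : Type*} [DecidableEq ι] (s : Finset ι) (h : ι → ℕ)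
    (hh : ∀ i ∈ s, 0 < h i) (n : ℕ) :
    PowerSeries.coeff n
        (∏ i ∈ s, PowerSeries.invOfUnit (1 - (PowerSeries.X : PowerSeries ℤ) ^ h i) 1) =
      (Nat.card {a : ι → ℕ // (∀ i, i ∉ s → a i = 0) ∧ ∑ i ∈ s, h i * a i = n} : ℤ) := by
  rw [Finset.prod_congr rfl fun i hi => invOfUnit_one_sub_X_pow (hh i hi), PowerSeries.coeff_prod]
  simp only [PowerSeries.coeff_mk, Finset.prod_boole, Finset.sum_boole]
  rw [← Nat.card_eq_finsetCard, Nat.cast_inj]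
  have hmul_div : ∀ l ∈ {l ∈ s.finsuppAntidiag n | ∀ i ∈ s, h i ∣ l i}, ∀ i ∈ s,
      h i * (l i / h i) = l i := fun l hl i hi =>
    Nat.mul_div_cancel' ((Finset.mem_filter.1 hl).2 i hi)
  have hvanish : ∀ l ∈ {l ∈ s.finsuppAntidiag n | ∀ i ∈ s, h i ∣ l i}, ∀ i, i ∉ s → l i = 0 :=
    fun l hl i hi => Finsupp.notMem_support_iff.1 fun hmem =>
      hi ((Finset.mem_finsuppAntidiag.1 (Finset.mem_filter.1 hl).1).2 hmem)
  refine Nat.card_eq_of_bijective (fun l => ⟨fun i => l.1 i / h i, fun i hi => ?_, ?_⟩) ⟨?_, ?_⟩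
  · simp only [hvanish l.1 l.2 i hi, Nat.zero_div]
  · rw [Finset.sum_congr rfl (hmul_div l.1 l.2)]
    exact (Finset.mem_finsuppAntidiag.1 (Finset.mem_filter.1 l.2).1).1
  · intro l m hlm
    refine Subtype.ext (Finsupp.ext fun i => ?_)
    by_cases hi : i ∈ s
    · have hquot : l.1 i / h i = m.1 i / h i := congrFun (congrArg Subtype.val hlm) i
      rw [← hmul_div l.1 l.2 i hi, hquot, hmul_div m.1 m.2 i hi]
    · rw [hvanish l.1 l.2 i hi, hvanish m.1 m.2 i hi]
  · rintro ⟨a, ha, hn⟩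
    refine ⟨⟨Finsupp.onFinset s (fun i => h i * a i) fun i hi => ?_, ?_⟩, ?_⟩
    · by_contra his
      exact hi (by rw [ha i his, mul_zero])
    · rw [Finset.mem_filter, Finset.mem_finsuppAntidiag]
      exact ⟨⟨hn, Finsupp.support_onFinset_subset⟩, fun i _ => dvd_mul_right _ _⟩
    · refine Subtype.ext (funext fun i => ?_)
      by_cases hi : i ∈ s
      · exact Nat.mul_div_cancel_left _ (hh i hi)
      · simp [ha i hi]

end HillmanGrassl

/-- **(Stanley, Hillman–Grassl).** For every partition `μ`,
`Σ_{n≥0} r_μ(n) qⁿ = ∏_{□∈μ} (1 − q^{h(□)})⁻¹` in `ℤ[[q]]`, where `r_μ(n)` is the number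
of reversed plane partitions of shape `μ` and size `n`, and `h(i,j) = μ_i + μ̄_j − i − j − 1`
is the hook length.  The inverse of `1 − q^{h(□)}` (whose constant coefficient is `1`)
is expressed via `PowerSeries.invOfUnit`. -/
theorem stanley_hillman_grassl (μ : YoungDiagram) :
    (PowerSeries.mk fun n => (rppCount μ n : ℤ))
      = ∏ c ∈ μ.cells,
          PowerSeries.invOfUnit
            (1 - (PowerSeries.X : PowerSeries ℤ)
                ^ (μ.rowLen c.1 + μ.colLen c.2 - c.1 - c.2 - 1)) 1 := by
  ext n
  rw [PowerSeries.coeff_mk, HillmanGrassl.rppCount_eq_card]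
  exact (HillmanGrassl.coeff_prod_invOfUnit μ.cells (HillmanGrassl.hookLength μ)
    (fun _ hx => HillmanGrassl.hookLength_pos hx) n).symm
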